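/- Let D ≥ 1 be an integer and β a real number. There is no numerical wall datum (r,c,d,e) for (D,β,0) with 6e/c > 4D². (Hence, in the (α,s)-slice of stability conditions with parameter β, there are no numerical — and thus no actual — walls for the β-twisted Chern character (0,0,D,0) in the region (s+1/6)α² > 2D²/3, so that region is contained in the Gieseker chamber.) -/

import Mathlib

noncomputable section

/-- A real number is an integer. -/
def IsIntR (x : ℝ) : Prop := ∃ n : ℤ, x = n

/-- `(a₀,a₁,a₂,a₃)` is a ℙ³-character: the integrality constraints satisfied by
Chern characters of objects of `D^b(ℙ³)`. -/
def IsP3Char (a₀ a₁ a₂ a₃ : ℝ) : Prop :=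
  IsIntR a₀ ∧ IsIntR a₁ ∧ IsIntR (a₂ - a₁ ^ 2 / 2) ∧ IsIntR (a₃ - a₁ / 6) ∧
    IsIntR (2 * a₃ - a₁ * a₂ + a₁ ^ 3 / 6)

/-- `(r,c,d,e)` is the β-twist of `(a₀,a₁,a₂,a₃)`. -/
def IsTwist (β r c d e a₀ a₁ a₂ a₃ : ℝ) : Prop :=
  r = a₀ ∧ c = a₁ - β * a₀ ∧ d = a₂ - β * a₁ + β ^ 2 / 2 * a₀ ∧
    e = a₃ - β * a₂ + β ^ 2 / 2 * a₁ - β ^ 3 / 6 * a₀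

/-- `(r,c,d,e)` is a numerical wall datum for `(D, β, R)`:  it is the β-twist of some
ℙ³-character, `c > 0`, and conditions (N1), (N2), (N3) hold. -/
def IsWallDatum (D : ℤ) (β : ℝ) (R : ℤ) (r c d e : ℝ) : Prop :=
  (∃ a₀ a₁ a₂ a₃ : ℝ, IsP3Char a₀ a₁ a₂ a₃ ∧ IsTwist β r c d e a₀ a₁ a₂ a₃) ∧
  0 < c ∧
  (0 < 2 * d ∧ 2 * d < 2 * (D : ℝ)) ∧
  (0 < c * (6 * e) ∧ c * (6 * e) ≤ min (4 * d ^ 2) (4 * ((D : ℝ) - d) ^ 2)) ∧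
  (-(c * (2 * (D : ℝ) - 2 * d)) / (6 * e) - (R : ℝ) ≤ r ∧ r ≤ c * (2 * d) / (6 * e))

theorem stmt6 (D : ℤ) (hD : 1 ≤ D) (β : ℝ) :
    ¬ ∃ r c d e : ℝ, IsWallDatum D β 0 r c d e ∧ 4 * (D : ℝ) ^ 2 < 6 * e / c := by
  rintro ⟨r, c, d, e, ⟨⟨a₀, a₁, a₂, a₃, ⟨⟨n, hn⟩, ⟨m, hm⟩, -⟩, hr, hc, -⟩, hc0, ⟨hd0, hdD⟩,
    ⟨-, hN2⟩, hlo, hhi⟩, hA⟩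
  have hD' : (1 : ℝ) ≤ D := by exact_mod_cast hD
  rw [lt_div_iff₀ hc0] at hA
  have he : 0 < 6 * e := by nlinarith [mul_pos hc0 (by positivity : (0 : ℝ) < 4 * (D : ℝ) ^ 2)]
  obtain ⟨h₁, h₂⟩ := le_min_iff.mp hN2
  have hmin : c * (6 * e) ≤ (D : ℝ) ^ 2 := by
    rcases le_total (2 * d) D with h | h <;> nlinarith
  have hc_half : c < 1 / 2 := by
    by_contra! h
    have h₃ : 4 * (D : ℝ) ^ 2 * c * c < c * (6 * e) := by nlinarith
    have h₄ : (1 : ℝ) / 4 ≤ c * c := by nlinarith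
    nlinarith [sq_nonneg (D : ℝ)]
  have hslope : c * (2 * (D : ℝ)) < 6 * e := by
    have h₃ : 2 * (D : ℝ) ≤ 4 * (D : ℝ) ^ 2 := by nlinarith
    nlinarith
  have hr_lt : r < 1 := by
    refine hhi.trans_lt ?_
    rw [div_lt_one he]
    nlinarith
  have hr_gt : -1 < r := by
    refine lt_of_lt_of_le ?_ hlo
    rw [Int.cast_zero, sub_zero, lt_div_iff₀ he]
    nlinarith
  have hn0 : n = 0 := by
    rw [hr, hn] at hr_lt hr_gt
    have h₃ : n < 1 := by exact_mod_cast hr_lt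
    have h₄ : -1 < n := by exact_mod_cast hr_gt
    omega
  have hcm : c = m := by rw [hc, hn, hn0, hm]; simp
  rw [hcm] at hc0 hc_half
  have h₃ : 0 < m := by exact_mod_cast hc0
  have h₄ : (1 : ℝ) ≤ m := by exact_mod_cast h₃
  linarith
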